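/- Short edges: every edge of a locally optimal geometric graph on ℤ² has Euclidean length 1 or √2. That is, if G is plane, has maximum degree at most 3, and satisfies d_G(p,q) ≤ (1+√2)·|p−q| for every pair p, q ∈ ℤ² with |p−q| ≤ √5, then for every edge {a,b} of G we have |a−b| = 1 or |a−b| = √2. -/

import Mathlib

open SimpleGraph ENNReal

/-- The point of the Euclidean plane (identified with `ℂ`) corresponding to a lattice point. -/
noncomputable def toC (p : ℤ × ℤ) : ℂ := ⟨(p.1 : ℝ), (p.2 : ℝ)⟩

/-- The Euclidean length of a walk in a geometric graph on `ℤ²`: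
the sum of the Euclidean lengths of its edges. -/
noncomputable def walkLen (G : SimpleGraph (ℤ × ℤ)) :
    ∀ {p q : ℤ × ℤ}, G.Walk p q → ℝ
  | _, _, .nil => 0
  | p, _, .cons (v := v) _ w => dist (toC p) (toC v) + walkLen G w

/-- The graph distance `d_G(p,q)`: infimum of Euclidean lengths of walks from `p` to `q`
(`∞` if there is no walk). -/
noncomputable def gdist (G : SimpleGraph (ℤ × ℤ)) (p q : ℤ × ℤ) : ℝ≥0∞ :=
  ⨅ w : G.Walk p q, ENNReal.ofReal (walkLen G w)

/-- `G` has maximum degree at most `3`. -/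
def MaxDegThree (G : SimpleGraph (ℤ × ℤ)) : Prop :=
  ∀ v : ℤ × ℤ, (G.neighborSet v).encard ≤ 3

/-- `G` is plane: two distinct edges, viewed as closed segments in the plane,
intersect at most in a common endpoint. -/
def IsPlane (G : SimpleGraph (ℤ × ℤ)) : Prop :=
  ∀ a b c d : ℤ × ℤ, G.Adj a b → G.Adj c d → s(a, b) ≠ s(c, d) →
    ∀ x : ℂ, x ∈ segment ℝ (toC a) (toC b) → x ∈ segment ℝ (toC c) (toC d) →
      x ∈ ({toC a, toC b} : Set ℂ) ∧ x ∈ ({toC c, toC d} : Set ℂ)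

/-- `G` is locally optimal. -/
def LocallyOptimal (G : SimpleGraph (ℤ × ℤ)) : Prop :=
  IsPlane G ∧ MaxDegThree G ∧
    ∀ p q : ℤ × ℤ, dist (toC p) (toC q) ≤ Real.sqrt 5 →
      gdist G p q ≤ ENNReal.ofReal ((1 + Real.sqrt 2) * dist (toC p) (toC q))

/-- The dilation of `G`. -/
noncomputable def dil (G : SimpleGraph (ℤ × ℤ)) : ℝ≥0∞ :=
  ⨆ (p : ℤ × ℤ) (q : ℤ × ℤ) (_ : p ≠ q),
    gdist G p q / ENNReal.ofReal (dist (toC p) (toC q))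

/-- `e, f` is an orthonormal basis of `ℤ²`. -/
def IsFrame (e f : ℤ × ℤ) : Prop :=
  e.1 ^ 2 + e.2 ^ 2 = 1 ∧ f.1 ^ 2 + f.2 ^ 2 = 1 ∧ e.1 * f.1 + e.2 * f.2 = 0

/-- The lattice point with coordinates `(i, j)` with respect to the origin `a` and axes `e, f`. -/
def framePt (a e f : ℤ × ℤ) (i j : ℤ) : ℤ × ℤ :=
  (a.1 + i * e.1 + j * f.1, a.2 + i * e.2 + j * f.2)

lemma IsFrame.symm {e f : ℤ × ℤ} (h : IsFrame e f) : IsFrame f e :=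
  ⟨h.2.1, h.1, by linarith [h.2.2]⟩

lemma IsFrame.neg_left {e f : ℤ × ℤ} (h : IsFrame e f) : IsFrame (-e) f := by
  obtain ⟨h1, h2, h3⟩ := h
  refine ⟨?_, h2, ?_⟩ <;> simp only [Prod.fst_neg, Prod.snd_neg] <;> linarith

lemma framePt_zero (a e f : ℤ × ℤ) : framePt a e f 0 0 = a := by
  simp [framePt]

lemma IsFrame.framePt_inj {e f : ℤ × ℤ} (h : IsFrame e f) {a : ℤ × ℤ} {i j k l : ℤ}
    (hp : framePt a e f i j = framePt a e f k l) : i = k ∧ j = l := by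
  obtain ⟨h1, h2, h3⟩ := h
  simp only [framePt, Prod.mk.injEq] at hp
  obtain ⟨hx, hy⟩ := hp
  constructor
  · linear_combination e.1 * hx + e.2 * hy + (k - i) * h1 + (l - j) * h3
  · linear_combination f.1 * hx + f.2 * hy + (k - i) * h3 + (l - j) * h2

lemma dist_toC (p q : ℤ × ℤ) :
    dist (toC p) (toC q) = Real.sqrt (((p.1 - q.1) ^ 2 + (p.2 - q.2) ^ 2 : ℤ) : ℝ) := by
  simp [toC, Complex.dist_eq_re_im]

lemma one_le_dist_toC {p q : ℤ × ℤ} (h : p ≠ q) : 1 ≤ dist (toC p) (toC q) := by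
  rw [dist_toC, Real.one_le_sqrt]
  have : p.1 - q.1 ≠ 0 ∨ p.2 - q.2 ≠ 0 := by
    by_contra! h'
    exact h (Prod.ext (by linarith [h'.1]) (by linarith [h'.2]))
  have : (1 : ℤ) ≤ (p.1 - q.1) ^ 2 + (p.2 - q.2) ^ 2 := by
    rcases this with h | h <;> nlinarith [sq_nonneg (p.1 - q.1), sq_nonneg (p.2 - q.2),
      pow_pos (abs_pos.mpr h) 2, sq_abs (p.1 - q.1), sq_abs (p.2 - q.2)]
  exact_mod_cast this

lemma walkLen_nonneg {G : SimpleGraph (ℤ × ℤ)} {p q : ℤ × ℤ} (w : G.Walk p q) :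
    0 ≤ walkLen G w := by
  induction w with
  | nil => simp [walkLen]
  | cons h w ih => simp only [walkLen]; positivity

lemma toC_injective : Function.Injective toC := by
  intro p q h
  simp only [toC, Complex.mk.injEq, Int.cast_inj] at h
  exact Prod.ext h.1 h.2

/-- No point in the open segment of an edge lies on another edge. -/
lemma IsPlane.not_crossing {G : SimpleGraph (ℤ × ℤ)} (hG : IsPlane G) {a b c d : ℤ × ℤ}
    (hab : G.Adj a b) (hcd : G.Adj c d) (hca : c ≠ a) (hcb : c ≠ b) {N s t : ℤ}
    (hs : 0 < s) (hsN : s < N) (ht : 0 ≤ t) (htN : t ≤ N)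
    (h1 : (N - s) * a.1 + s * b.1 = (N - t) * c.1 + t * d.1)
    (h2 : (N - s) * a.2 + s * b.2 = (N - t) * c.2 + t * d.2) : False := by
  have hne : s(a, b) ≠ s(c, d) := by
    intro h
    have : c ∈ s(a, b) := h ▸ Sym2.mem_mk_left c d
    rcases Sym2.mem_iff.mp this with h | h
    exacts [hca h, hcb h]
  have hN : (0 : ℝ) < N := by exact_mod_cast hs.trans hsN
  have hs' : (0 : ℝ) < s := by exact_mod_cast hs
  have hsN' : (s : ℝ) < N := by exact_mod_cast hsN
  have ht' : (0 : ℝ) ≤ t := by exact_mod_cast ht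
  have htN' : (t : ℝ) ≤ N := by exact_mod_cast htN
  have h1' : ((N : ℝ) - s) * a.1 + s * b.1 = (N - t) * c.1 + t * d.1 := by exact_mod_cast h1
  have h2' : ((N : ℝ) - s) * a.2 + s * b.2 = (N - t) * c.2 + t * d.2 := by exact_mod_cast h2
  have hxo : ((N - s) / N : ℝ) • toC a + (s / N : ℝ) • toC b ∈
      openSegment ℝ (toC a) (toC b) :=
    ⟨(N - s) / N, s / N, div_pos (by linarith) hN, by positivity, by field_simp; ring, rfl⟩
  have hxc : ((N - s) / N : ℝ) • toC a + (s / N : ℝ) • toC b ∈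
      segment ℝ (toC c) (toC d) := by
    refine ⟨(N - t) / N, t / N, div_nonneg (by linarith) hN.le, by positivity,
      by field_simp; ring, ?_⟩
    apply Complex.ext
    · simp only [toC, Complex.add_re, Complex.smul_re, smul_eq_mul]
      field_simp
      linarith
    · simp only [toC, Complex.add_im, Complex.smul_im, smul_eq_mul]
      field_simp
      linarith
  have hne' : toC a ≠ toC b := fun h => hab.ne (toC_injective h)
  rcases (hG a b c d hab hcd hne _ (openSegment_subset_segment _ _ _ hxo) hxc).1 with h | h
  · rw [h, left_mem_openSegment_iff] at hxo
    exact hne' hxo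
  · rw [Set.mem_singleton_iff.mp h, right_mem_openSegment_iff] at hxo
    exact hne' hxo

lemma MaxDegThree.not_four {G : SimpleGraph (ℤ × ℤ)} (hG : MaxDegThree G) {v w x y z : ℤ × ℤ}
    (hw : G.Adj v w) (hx : G.Adj v x) (hy : G.Adj v y) (hz : G.Adj v z)
    (hwx : w ≠ x) (hwy : w ≠ y) (hwz : w ≠ z) (hxy : x ≠ y) (hxz : x ≠ z) (hyz : y ≠ z) :
    False := by
  have hsub : ({w, x, y, z} : Set (ℤ × ℤ)) ⊆ G.neighborSet v := by
    rintro u (rfl | rfl | rfl | rfl) <;> assumption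
  have hcard : ({w, x, y, z} : Set (ℤ × ℤ)).encard = 4 := by
    rw [Set.encard_insert_of_notMem (by simp [*]), Set.encard_insert_of_notMem (by simp [*]),
      Set.encard_pair hyz]
    norm_num
  have := (Set.encard_le_encard hsub).trans (hG v)
  rw [hcard] at this
  exact absurd this (by decide)

/-- A lattice point whose distances to `p` and to a neighbour at distance `1` sum to less
than `5 / 2` is a vertex of one of the two unit squares sharing that unit segment. -/
lemma IsFrame.exists_framePt {e f : ℤ × ℤ} (h : IsFrame e f) {p v : ℤ × ℤ} (hpv : p ≠ v)
    (hvq : v ≠ framePt p e f 1 0)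
    (hd : dist (toC p) (toC v) + dist (toC v) (toC (framePt p e f 1 0)) < 5 / 2) :
    ∃ i j : ℤ, v = framePt p e f i j ∧ (i = 0 ∨ i = 1) ∧ (j = 1 ∨ j = -1) := by
  have hA := one_le_dist_toC hpv
  have hB := one_le_dist_toC hvq
  obtain ⟨i, j, rfl⟩ : ∃ i j : ℤ, v = framePt p e f i j := by
    obtain ⟨h1, h2, h3⟩ := h
    have h4 : e.1 ^ 2 + f.1 ^ 2 = 1 := by
      linear_combination (e.1 * f.1 - e.2 * f.2) * h3 + f.2 ^ 2 * h1 + (1 - e.1 ^ 2) * h2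
    have h5 : e.2 ^ 2 + f.2 ^ 2 = 1 := by linarith
    have h6 : e.1 * e.2 + f.1 * f.2 = 0 := by
      linear_combination (e.2 * f.1 + e.1 * f.2) * h3 - e.1 * e.2 * h2 - f.1 * f.2 * h1
    refine ⟨e.1 * (v.1 - p.1) + e.2 * (v.2 - p.2), f.1 * (v.1 - p.1) + f.2 * (v.2 - p.2),
      Prod.ext ?_ ?_⟩ <;> simp only [framePt]
    · linear_combination (p.1 - v.1) * h4 + (p.2 - v.2) * h6
    · linear_combination (p.1 - v.1) * h6 + (p.2 - v.2) * h5
  refine ⟨i, j, rfl, ?_⟩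
  obtain ⟨h1, h2, h3⟩ := h
  have eA : (p.1 - (framePt p e f i j).1) ^ 2 + (p.2 - (framePt p e f i j).2) ^ 2 =
      i ^ 2 + j ^ 2 := by
    simp only [framePt]
    linear_combination i ^ 2 * h1 + j ^ 2 * h2 + 2 * i * j * h3
  have eB : ((framePt p e f i j).1 - (framePt p e f 1 0).1) ^ 2 +
      ((framePt p e f i j).2 - (framePt p e f 1 0).2) ^ 2 = (i - 1) ^ 2 + j ^ 2 := by
    simp only [framePt]
    linear_combination (i - 1) ^ 2 * h1 + j ^ 2 * h2 + 2 * (i - 1) * j * h3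
  rw [dist_toC, eA] at hd hA
  rw [dist_toC, eB] at hd hB
  have hA2 : ((i ^ 2 + j ^ 2 : ℤ) : ℝ) = √((i ^ 2 + j ^ 2 : ℤ) : ℝ) ^ 2 :=
    (Real.sq_sqrt (by positivity)).symm
  have hB2 : (((i - 1) ^ 2 + j ^ 2 : ℤ) : ℝ) = √(((i - 1) ^ 2 + j ^ 2 : ℤ) : ℝ) ^ 2 :=
    (Real.sq_sqrt (by positivity)).symm
  have hA0 : 1 ≤ i ^ 2 + j ^ 2 := by exact_mod_cast Real.one_le_sqrt.mp hA
  have hB0 : 1 ≤ (i - 1) ^ 2 + j ^ 2 := by exact_mod_cast Real.one_le_sqrt.mp hB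
  have hsum : (i ^ 2 + j ^ 2) + ((i - 1) ^ 2 + j ^ 2) < 4 := by
    have : (((i ^ 2 + j ^ 2 : ℤ) : ℝ) + (((i - 1) ^ 2 + j ^ 2 : ℤ) : ℝ)) < 4 := by
      rw [hA2, hB2]
      nlinarith
    exact_mod_cast this
  have hi0 : -1 < i := by nlinarith [sq_nonneg j]
  have hi1 : i < 2 := by nlinarith [sq_nonneg j]
  have hj0 : -2 < j := by nlinarith [sq_nonneg i, sq_nonneg (i - 1)]
  have hj1 : j < 2 := by nlinarith [sq_nonneg i, sq_nonneg (i - 1)]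
  interval_cases i <;> interval_cases j <;> simp_all

/-- Two lattice points at distance `1` are adjacent or have a common neighbour which is a vertex
of one of the two unit squares containing both. -/
lemma LocallyOptimal.adj_or_common_neighbor {G : SimpleGraph (ℤ × ℤ)} (hG : LocallyOptimal G)
    {e f : ℤ × ℤ} (h : IsFrame e f) (p : ℤ × ℤ) :
    G.Adj p (framePt p e f 1 0) ∨ ∃ i j : ℤ, (i = 0 ∨ i = 1) ∧ (j = 1 ∨ j = -1) ∧
      G.Adj p (framePt p e f i j) ∧ G.Adj (framePt p e f i j) (framePt p e f 1 0) := by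
  have hpq : dist (toC p) (toC (framePt p e f 1 0)) = 1 := by
    rw [dist_toC, Real.sqrt_eq_one]
    have : (p.1 - (framePt p e f 1 0).1) ^ 2 + (p.2 - (framePt p e f 1 0).2) ^ 2 = 1 := by
      simp only [framePt]
      linear_combination h.1
    rw [this, Int.cast_one]
  have hle := hG.2.2 p (framePt p e f 1 0) (by rw [hpq, Real.one_le_sqrt]; norm_num)
  have hsqrt : Real.sqrt 2 < 3 / 2 := by
    rw [Real.sqrt_lt' (by norm_num)]; norm_num
  have hlt : gdist G p (framePt p e f 1 0) < ENNReal.ofReal (5 / 2) :=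
    hle.trans_lt ((ENNReal.ofReal_lt_ofReal_iff (by norm_num)).mpr (by rw [hpq]; linarith))
  obtain ⟨w, hw⟩ := iInf_lt_iff.mp hlt
  rw [ENNReal.ofReal_lt_ofReal_iff (by norm_num)] at hw
  generalize hq : framePt p e f 1 0 = q at w
  cases w with
  | nil =>
    simp [hq] at hpq
  | cons h1 w =>
    cases w with
    | nil => exact Or.inl h1
    | cons h2 w =>
      cases w with
      | nil =>
        subst hq
        simp only [walkLen, add_zero] at hw
        obtain ⟨i, j, rfl, hi, hj⟩ := h.exists_framePt h1.ne h2.ne hw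
        exact Or.inr ⟨i, j, hi, hj, h1, h2⟩
      | cons h3 w =>
        simp only [walkLen] at hw
        linarith [one_le_dist_toC h1.ne, one_le_dist_toC h2.ne, one_le_dist_toC h3.ne,
          walkLen_nonneg w]

lemma LocallyOptimal.not_adj_of_adj_of_adj {G : SimpleGraph (ℤ × ℤ)} (hG : LocallyOptimal G)
    {e f : ℤ × ℤ} (h : IsFrame e f) {a : ℤ × ℤ} {m n : ℤ} (hm : 2 ≤ m)
    (h1 : G.Adj a (framePt a e f 1 0)) (h2 : G.Adj a (framePt a e f 1 1)) :
    ¬ G.Adj a (framePt a e f m n) := by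
  intro h3
  obtain ⟨k, l, hkl, h4⟩ : ∃ k l : ℤ, (k < 1 ∧ G.Adj a (framePt a e f k l)) := by
    have hneg : ∀ i j, framePt a (-e) f i j = framePt a e f (-i) j := by
      intro i j; simp [framePt]
    have := hG.adj_or_common_neighbor h.neg_left a
    simp only [hneg] at this
    rcases this with h4 | ⟨i, j, hi, -, h4, -⟩
    · exact ⟨_, _, by norm_num, h4⟩
    · exact ⟨_, _, by omega, h4⟩
  refine hG.2.1.not_four h1 h2 h3 h4 ?_ ?_ ?_ ?_ ?_ ?_ <;> intro heq <;>
    have := h.framePt_inj heq <;> omega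

lemma LocallyOptimal.not_crossing_framePt {G : SimpleGraph (ℤ × ℤ)} (hG : LocallyOptimal G)
    {e f : ℤ × ℤ} (h : IsFrame e f) {a : ℤ × ℤ} {m n j k l : ℤ} (hm : 2 ≤ m)
    (hab : G.Adj a (framePt a e f m n)) (hcd : G.Adj (framePt a e f 1 j) (framePt a e f k l))
    (N s t : ℤ) (hs : 0 < s) (hsN : s < N) (ht : 0 ≤ t) (htN : t ≤ N)
    (h1 : s * m = (N - t) + t * k) (h2 : s * n = (N - t) * j + t * l) : False := by
  refine hG.1.not_crossing hab hcd ?_ ?_ hs hsN ht htN ?_ ?_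
  · intro heq
    have := h.framePt_inj (heq.trans (framePt_zero a e f).symm)
    omega
  · intro heq
    have := h.framePt_inj heq
    omega
  · simp only [framePt]
    linear_combination e.1 * h1 + f.1 * h2
  · simp only [framePt]
    linear_combination e.2 * h1 + f.2 * h2

/-- A locally optimal graph has no edge with a coordinate difference of at least `2`. -/
lemma LocallyOptimal.not_adj_framePt {G : SimpleGraph (ℤ × ℤ)} (hG : LocallyOptimal G)
    {e f : ℤ × ℤ} (h : IsFrame e f) {a : ℤ × ℤ} {m n : ℤ} (hm : 2 ≤ m) (hn : 0 ≤ n)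
    (hnm : n ≤ m) : ¬ G.Adj a (framePt a e f m n) := by
  intro hab
  have htrans : ∀ i j, framePt (framePt a e f 1 0) f e i j = framePt a e f (1 + j) i := by
    intro i j
    simp only [framePt, Prod.mk.injEq]
    constructor <;> ring
  have key := hG.adj_or_common_neighbor h.symm (framePt a e f 1 0)
  simp only [htrans] at key
  have cross := fun j k l => hG.not_crossing_framePt h (j := j) (k := k) (l := l) hm hab
  rcases hn.eq_or_lt with rfl | hn
  · rcases key with h1 | ⟨i, j, -, -, h1, -⟩ <;>
      exact cross _ _ _ h1 m 1 0 (by omega) (by omega) (by omega) (by omega) (by ring) (by ring)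
  rcases hnm.eq_or_lt with rfl | hnm
  · rcases key with h1 | ⟨i, j, -, -, -, h1⟩
    · exact cross _ _ _ h1.symm n 1 0 (by omega) (by omega) (by omega) (by omega) (by ring)
        (by ring)
    · exact cross _ _ _ h1.symm n 1 0 (by omega) (by omega) (by omega) (by omega) (by ring)
        (by ring)
  rcases key with h1 | ⟨i, j, rfl | rfl, rfl | rfl, h1, h2⟩
  · exact cross _ _ _ h1 m 1 n (by omega) (by omega) (by omega) (by omega) (by ring) (by ring)
  · norm_num at h1 h2
    exact cross _ _ _ h2.symm (m + n) 2 (m - n) (by omega) (by omega) (by omega) (by omega)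
      (by ring) (by ring)
  · norm_num at h1 h2
    rw [framePt_zero] at h1 h2
    exact hG.not_adj_of_adj_of_adj h hm h1.symm h2 hab
  · norm_num at h1 h2
    rcases le_or_gt (2 * n) m with hmn | hmn
    · by_cases hb : m - n = 1
      · obtain rfl : n = 1 := by omega
        obtain rfl : m = 2 := by omega
        have hneg : ∀ i j, framePt (framePt a e f 2 1) (-e) (-f) i j =
            framePt a e f (2 - i) (1 - j) := by
          intro i j
          simp only [framePt, Prod.fst_neg, Prod.snd_neg, Prod.mk.injEq]
          constructor <;> ring
        refine hG.not_adj_of_adj_of_adj (a := framePt a e f 2 1) (m := 2) (n := 1)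
          h.neg_left.symm.neg_left.symm le_rfl ?_ ?_ ?_ <;> rw [hneg] <;> norm_num
        · exact h2
        · exact h1.symm
        · rw [framePt_zero]; exact hab.symm
      · exact cross _ _ _ h1 (m - n) 1 n (by omega) (by omega) (by omega) (by omega) (by ring)
          (by ring)
    · exact cross _ _ _ h2.symm n 1 (m - n) (by omega) (by omega) (by omega) (by omega)
        (by ring) (by ring)
  · norm_num at h1 h2
    exact cross _ _ _ h1 (m + n) 1 n (by omega) (by omega) (by omega) (by omega) (by ring)
      (by ring)

lemma exists_isFrame_framePt (a b : ℤ × ℤ) : ∃ e f m n, IsFrame e f ∧ 0 ≤ n ∧ n ≤ m ∧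
    b = framePt a e f m n := by
  have habs : ∀ x : ℤ, ∃ s : ℤ, s ^ 2 = 1 ∧ x = |x| * s := by
    intro x
    rcases abs_choice x with h | h
    · exact ⟨1, by norm_num, by linarith⟩
    · exact ⟨-1, by norm_num, by linarith⟩
  obtain ⟨s, hs, hxs⟩ := habs (b.1 - a.1)
  obtain ⟨t, ht, hyt⟩ := habs (b.2 - a.2)
  rcases le_total |b.2 - a.2| |b.1 - a.1| with hle | hle
  · refine ⟨(s, 0), (0, t), _, _, ⟨?_, ?_, ?_⟩, abs_nonneg _, hle, Prod.ext ?_ ?_⟩ <;>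
      simp only [framePt] <;> linarith
  · refine ⟨(0, t), (s, 0), _, _, ⟨?_, ?_, ?_⟩, abs_nonneg _, hle, Prod.ext ?_ ?_⟩ <;>
      simp only [framePt] <;> linarith

/-- Short edges: every edge of a locally optimal graph has length 1 or √2. -/
theorem short_edges (G : SimpleGraph (ℤ × ℤ)) (hG : LocallyOptimal G)
    (a b : ℤ × ℤ) (hab : G.Adj a b) :
    dist (toC a) (toC b) = 1 ∨ dist (toC a) (toC b) = Real.sqrt 2 := by
  obtain ⟨e, f, m, n, h, hn, hnm, rfl⟩ := exists_isFrame_framePt a b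
  have hm : m < 2 := by
    by_contra! hm
    exact hG.not_adj_framePt h hm hn hnm hab
  have hd : (a.1 - (framePt a e f m n).1) ^ 2 + (a.2 - (framePt a e f m n).2) ^ 2 =
      m ^ 2 + n ^ 2 := by
    obtain ⟨h1, h2, h3⟩ := h
    simp only [framePt]
    linear_combination m ^ 2 * h1 + n ^ 2 * h2 + 2 * m * n * h3
  rw [dist_toC, hd]
  obtain rfl | rfl : m = 0 ∨ m = 1 := by omega
  · obtain rfl : n = 0 := by omega
    rw [framePt_zero] at hab
    exact absurd hab G.irrefl
  · obtain rfl | rfl : n = 0 ∨ n = 1 := by omega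
    · left; norm_num
    · right; norm_num
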